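/- A strongly connected digraph G admits an expansion φ : G' → G with G' a cactus digraph if and only if G has no doubly bidirectionally connected pair. -/

import Mathlib

structure DirGraph (V : Type) where
  Adj : V → V → Prop
  loopless : ∀ v, ¬ Adj v v

namespace DirGraph

variable {V V' : Type}

/-- A walk is a nonempty list of vertices with consecutive arcs. -/
def IsWalk (G : DirGraph V) : List V → Prop
  | [] => False
  | [_] => True
  | a :: b :: l => G.Adj a b ∧ G.IsWalk (b :: l)

def IsWalkFromTo (G : DirGraph V) (p : List V) (x y : V) : Prop :=
  G.IsWalk p ∧ p.head? = some x ∧ p.getLast? = some y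

def StronglyConnected (G : DirGraph V) : Prop :=
  ∀ x y : V, ∃ p, G.IsWalkFromTo p x y

def IsSimplePath (G : DirGraph V) (p : List V) : Prop :=
  G.IsWalk p ∧ p.Nodup

def IsSimplePathFromTo (G : DirGraph V) (p : List V) (x y : V) : Prop :=
  G.IsSimplePath p ∧ p.head? = some x ∧ p.getLast? = some y

/-- The arcs of a walk given as a list of vertices. -/
def arcs (p : List V) : List (V × V) := p.zip p.tail

/-- The preterminal (second-to-last) vertex of a path. -/
def preterminal (p : List V) : Option V := p.dropLast.getLast?

/-- A simple cycle: a closed walk whose vertices are distinct except for the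
repeated endpoint. -/
def IsSimpleCycle (G : DirGraph V) (p : List V) : Prop :=
  G.IsWalk p ∧ 2 ≤ p.length ∧ p.head? = p.getLast? ∧ p.dropLast.Nodup

/-- Two cycles are equal as cycles when they have the same set of arcs. -/
def CycleEquiv (p q : List V) : Prop :=
  ∀ a : V × V, a ∈ arcs p ↔ a ∈ arcs q

/-- Each arc lies in exactly one simple cycle (up to arc-set equality). -/
def CactusArcCond (G : DirGraph V) : Prop :=
  ∀ x y, G.Adj x y →
    (∃ p, G.IsSimpleCycle p ∧ (x, y) ∈ arcs p) ∧
    (∀ p q, G.IsSimpleCycle p → (x, y) ∈ arcs p →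
      G.IsSimpleCycle q → (x, y) ∈ arcs q → CycleEquiv p q)

/-- A cactus digraph: strongly connected and each arc lies in exactly one
simple cycle. -/
def IsCactus (G : DirGraph V) : Prop :=
  G.StronglyConnected ∧ G.CactusArcCond

noncomputable def inDeg (G : DirGraph V) (v : V) : ℕ := Nat.card {u // G.Adj u v}
noncomputable def outDeg (G : DirGraph V) (v : V) : ℕ := Nat.card {u // G.Adj v u}

/-- A connecting point: a vertex shared by two distinct simple cycles. -/
def IsConnectingPoint (G : DirGraph V) (v : V) : Prop :=
  ∃ p q, G.IsSimpleCycle p ∧ G.IsSimpleCycle q ∧ ¬ CycleEquiv p q ∧ v ∈ p ∧ v ∈ q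

/-- An expansion of digraphs. -/
structure IsExpansion (G' : DirGraph V') (G : DirGraph V) (φ : V' → V) : Prop where
  map_adj : ∀ ⦃x y⦄, G'.Adj x y → G.Adj (φ x) (φ y)
  vert_surj : Function.Surjective φ
  arc_surj : ∀ ⦃x y⦄, G.Adj x y → ∃ x' y', G'.Adj x' y' ∧ φ x' = x ∧ φ y' = y
  lift : ∀ ⦃x y⦄, G.Adj x y → ∀ y', φ y' = y → ∃! x', G'.Adj x' y' ∧ φ x' = x

/-- A doubly bidirectionally connected pair. -/
def Dbcp (G : DirGraph V) (p q : V) : Prop :=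
  p ≠ q ∧
  (∃ P Q, G.IsSimplePathFromTo P p q ∧ G.IsSimplePathFromTo Q p q ∧
    preterminal P ≠ preterminal Q) ∧
  (∃ P Q, G.IsSimplePathFromTo P q p ∧ G.IsSimplePathFromTo Q q p ∧
    preterminal P ≠ preterminal Q)

/-- Subgraph of a digraph: a vertex subset together with a subrelation of arcs
supported on it. -/
structure Subgraph (G : DirGraph V) where
  verts : Set V
  Adj : V → V → Prop
  adj_sub : ∀ ⦃x y⦄, Adj x y → G.Adj x y
  mem_left : ∀ ⦃x y⦄, Adj x y → x ∈ verts
  mem_right : ∀ ⦃x y⦄, Adj x y → y ∈ verts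

def Subgraph.toDirGraph {G : DirGraph V} (H : Subgraph G) : DirGraph V :=
  ⟨H.Adj, fun v h => G.loopless v (H.adj_sub h)⟩

/-- A sub-cactus digraph: a nonempty subgraph that is strongly connected (on
its vertex set) and in which each arc lies in exactly one simple cycle. -/
def Subgraph.IsCactus {G : DirGraph V} (H : Subgraph G) : Prop :=
  H.verts.Nonempty ∧
  (∀ x ∈ H.verts, ∀ y ∈ H.verts, ∃ p, H.toDirGraph.IsWalkFromTo p x y) ∧
  H.toDirGraph.CactusArcCond

def Subgraph.inter {G : DirGraph V} (H K : Subgraph G) : Subgraph G where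
  verts := H.verts ∩ K.verts
  Adj x y := H.Adj x y ∧ K.Adj x y
  adj_sub := fun _ _ h => H.adj_sub h.1
  mem_left := fun _ _ h => ⟨H.mem_left h.1, K.mem_left h.2⟩
  mem_right := fun _ _ h => ⟨H.mem_right h.1, K.mem_right h.2⟩

def Subgraph.le {G : DirGraph V} (H K : Subgraph G) : Prop :=
  H.verts ⊆ K.verts ∧ ∀ ⦃x y⦄, H.Adj x y → K.Adj x y

/-- The single-vertex subgraph. -/
def singleVert (G : DirGraph V) (v : V) : Subgraph G where
  verts := {v}
  Adj _ _ := False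
  adj_sub := by intro _ _ h; exact h.elim
  mem_left := by intro _ _ h; exact h.elim
  mem_right := by intro _ _ h; exact h.elim

/-- The intersection of all sub-cactus digraphs of `G` containing `W`. -/
def CsubOf (G : DirGraph V) (W : Set V) : Subgraph G where
  verts := {x | ∀ H : Subgraph G, H.IsCactus → W ⊆ H.verts → x ∈ H.verts}
  Adj x y := G.Adj x y ∧ ∀ H : Subgraph G, H.IsCactus → W ⊆ H.verts → H.Adj x y
  adj_sub := fun _ _ h => h.1
  mem_left := fun _ _ h H hH hW => H.mem_left (h.2 H hH hW)
  mem_right := fun _ _ h H hH hW => H.mem_right (h.2 H hH hW)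

open Classical in
/-- `C G r v`: the minimum sub-cactus digraph containing `{r, v}` (and the
single vertex `{r}` when `v = r`). -/
noncomputable def C (G : DirGraph V) (r v : V) : Subgraph G :=
  if v = r then singleVert G r else CsubOf G {r, v}

/-- The preorder on vertices of the rooted cactus digraph `(G, r)`:
`v ≼ w ↔ C(v) ⊆ C(w)`. -/
def pre (G : DirGraph V) (r v w : V) : Prop :=
  Subgraph.le (C G r v) (C G r w)

end DirGraph

namespace DirGraph

section basics

variable {W : Type} {G : DirGraph W}

/-- `w` reaches `a` avoiding `v`. -/
def RA (G : DirGraph W) (v w a : W) : Prop :=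
  w ≠ v ∧ Relation.ReflTransGen (fun s t => G.Adj s t ∧ t ≠ v) w a

/-- `w` lies in the branch at `v` of the arc `(a, v)`. -/
def Br (G : DirGraph W) (a v w : W) : Prop := G.Adj a v ∧ G.RA v w a

/-- `w` lies in two different branches at `v`. -/
def Dbl (G : DirGraph W) (w v : W) : Prop := ∃ a b, a ≠ b ∧ G.Br a v w ∧ G.Br b v w

theorem RA.refl {v w : W} (h : w ≠ v) : G.RA v w w := ⟨h, .refl⟩

theorem RA.tail {v w a b : W} (h : G.RA v w a) (hab : G.Adj a b) (hb : b ≠ v) : G.RA v w b :=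
  ⟨h.1, h.2.tail ⟨hab, hb⟩⟩

theorem RA.ne_right {v w a : W} (h : G.RA v w a) : a ≠ v := by
  obtain ⟨h1, h2⟩ := h
  induction h2 with
  | refl => exact h1
  | tail _ h _ => exact h.2

theorem RA.trans {v w a b : W} (h : G.RA v w a) (h' : G.RA v a b) : G.RA v w b :=
  ⟨h.1, h.2.trans h'.2⟩

theorem RA.head {v w a b : W} (hw : w ≠ v) (hab : G.Adj w a) (h : G.RA v a b) : G.RA v w b :=
  ⟨hw, Relation.ReflTransGen.head ⟨hab, h.1⟩ h.2⟩

theorem RA.split {v w a : W} (u : W) (h : G.RA v w a) :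
    G.RA u w a ∨ (G.RA v w u ∧ G.RA v u a) := by
  obtain ⟨h1, h2⟩ := h
  induction h2 with
  | refl =>
    by_cases hu : w = u
    · subst hu; exact .inr ⟨RA.refl h1, RA.refl h1⟩
    · exact .inl (RA.refl hu)
  | @tail b c hb hc ih =>
    rcases ih with ih | ⟨i1, i2⟩
    · by_cases hu : c = u
      · subst hu
        exact .inr ⟨⟨h1, hb.tail hc⟩, RA.refl hc.2⟩
      · exact .inl (ih.tail hc.1 hu)
    · exact .inr ⟨i1, i2.tail hc.1 hc.2⟩

theorem isWalk_iff {p : List W} : G.IsWalk p ↔ p ≠ [] ∧ List.IsChain G.Adj p := by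
  induction p with
  | nil => simp [IsWalk]
  | cons a l ih =>
    cases l with
    | nil => simp [IsWalk]
    | cons b l => simp [IsWalk, ih]

theorem reach_of_walk {p : List W} {x y : W} (h : G.IsWalkFromTo p x y) :
    Relation.ReflTransGen G.Adj x y := by
  induction p generalizing x with
  | nil => exact h.1.elim
  | cons a l ih =>
    obtain ⟨h1, h2, h3⟩ := h
    simp at h2
    subst h2
    cases l with
    | nil => simp at h3; subst h3; exact .refl
    | cons b l =>
      exact .head h1.1 (ih ⟨h1.2, by simp, by simpa using h3⟩)

theorem walk_of_reach {x y : W} (h : Relation.ReflTransGen G.Adj x y) :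
    ∃ p, G.IsWalkFromTo p x y := by
  induction h using Relation.ReflTransGen.head_induction_on with
  | refl => exact ⟨[y], by simp [IsWalkFromTo, IsWalk]⟩
  | @head a b hab _ ih =>
    obtain ⟨p, h1, h2, h3⟩ := ih
    cases p with
    | nil => exact h1.elim
    | cons c l =>
      simp at h2
      subst h2
      exact ⟨a :: c :: l, ⟨hab, h1⟩, by simp, by simpa using h3⟩

theorem sc_iff : G.StronglyConnected ↔ ∀ x y, Relation.ReflTransGen G.Adj x y :=
  ⟨fun h x y => let ⟨_, hp⟩ := h x y; reach_of_walk hp, fun h x y => walk_of_reach (h x y)⟩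

theorem exists_br {w v : W} (h : Relation.ReflTransGen G.Adj w v) (hne : w ≠ v) :
    ∃ a, G.Br a v w := by
  have key : ∀ x, Relation.ReflTransGen G.Adj w x → G.RA v w x ∨ ∃ a, G.Br a v w := by
    intro x hx
    induction hx with
    | refl => exact .inl (RA.refl hne)
    | @tail b c _ hc ih =>
      rcases ih with ih | ih
      · by_cases hcv : c = v
        · subst hcv; exact .inr ⟨b, hc, ih⟩
        · exact .inl (ih.tail hc hcv)
      · exact .inr ih
  rcases key v h with h | h
  · exact (h.ne_right rfl).elim
  · exact h

theorem exists_out {w v : W} (h : Relation.ReflTransGen G.Adj v w) (hne : w ≠ v) :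
    ∃ c, G.Adj v c ∧ G.RA v c w := by
  have key : ∀ x, Relation.ReflTransGen G.Adj x w → G.RA v x w ∨ ∃ c, G.Adj v c ∧ G.RA v c w := by
    intro x hx
    induction hx using Relation.ReflTransGen.head_induction_on with
    | refl => exact .inl (RA.refl hne)
    | @head b c hc _ ih =>
      rcases ih with ih | ih
      · by_cases hcv : b = v
        · subst hcv; exact .inr ⟨c, hc, ih⟩
        · exact .inl (ih.head hcv hc)
      · exact .inr ih
  rcases key v h with h | h
  · exact (h.1 rfl).elim
  · exact h

theorem RA.exists_path {v w a : W} (h : G.RA v w a) :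
    ∃ P, G.IsSimplePathFromTo P w a ∧ v ∉ P := by
  obtain ⟨h1, h2⟩ := h
  induction h2 using Relation.ReflTransGen.head_induction_on with
  | refl => exact ⟨[a], by simp [IsSimplePathFromTo, IsSimplePath, IsWalk], by simpa using h1.symm⟩
  | @head b c hbc _ ih =>
    obtain ⟨P, ⟨⟨hw, hn⟩, hh, hl⟩, hv⟩ := ih hbc.2
    by_cases hb : b ∈ P
    · obtain ⟨s, t, rfl⟩ := List.append_of_mem hb
      refine ⟨b :: t, ⟨⟨?_, ?_⟩, by simp, ?_⟩, ?_⟩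
      · rw [isWalk_iff] at hw ⊢
        exact ⟨by simp, hw.2.right_of_append⟩
      · exact (List.nodup_append.1 hn).2.1
      · simpa [List.getLast?_append] using hl
      · intro h; exact hv (List.mem_append_right _ h)
    · cases P with
      | nil => exact hw.elim
      | cons d l =>
        simp at hh
        subst hh
        refine ⟨b :: d :: l, ⟨⟨⟨hbc.1, hw⟩, List.nodup_cons.2 ⟨hb, hn⟩⟩, by simp, by simpa using hl⟩, ?_⟩
        intro h
        rcases List.mem_cons.1 h with h | h
        · exact h1 h.symm
        · exact hv h

theorem RA.of_path {v w a : W} {P : List W} (hP : G.IsWalkFromTo P w a) (hv : v ∉ P) :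
    G.RA v w a := by
  induction P generalizing w with
  | nil => exact hP.1.elim
  | cons b l ih =>
    obtain ⟨h1, h2, h3⟩ := hP
    simp at h2
    subst h2
    simp only [List.mem_cons, not_or] at hv
    cases l with
    | nil => simp at h3; subst h3; exact RA.refl (Ne.symm hv.1)
    | cons c l => exact RA.head (Ne.symm hv.1) h1.1 (ih ⟨h1.2, by simp, by simpa using h3⟩ hv.2)

/-- Decomposition of a simple path with distinct endpoints. -/
theorem path_decomp {p q : W} {P : List W} (hne : p ≠ q) (h : G.IsSimplePathFromTo P p q) :
    ∃ a P0, P = P0 ++ [q] ∧ G.IsSimplePathFromTo P0 p a ∧ q ∉ P0 ∧ preterminal P = some a ∧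
      G.Br a q p := by
  obtain ⟨⟨hw, hn⟩, hh, hl⟩ := h
  obtain ⟨P0, rfl⟩ : ∃ P0, P = P0 ++ [q] := List.getLast?_eq_some_iff.1 hl
  rcases List.eq_nil_or_concat' P0 with rfl | ⟨P1, a, rfl⟩
  · simp at hh; exact (hne hh.symm).elim
  · have hq : q ∉ P1 ++ [a] := by
      intro hq
      have := List.nodup_append.1 hn
      exact this.2.2 q hq q (by simp) rfl
    have hh' : (P1 ++ [a]).head? = some p := by
      cases P1 <;> simpa using hh
    rw [isWalk_iff, List.isChain_append] at hw
    have hw0 : G.IsWalk (P1 ++ [a]) := by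
      rw [isWalk_iff]; exact ⟨by simp, hw.2.1⟩
    have hadj : G.Adj a q := hw.2.2.2 a (by simp) q (by simp)
    refine ⟨a, P1 ++ [a], rfl, ⟨⟨hw0, (List.nodup_append.1 hn).1⟩, hh', by simp⟩, hq,
      by simp [preterminal], hadj, RA.of_path ⟨hw0, hh', by simp⟩ hq⟩

theorem Br.exists_path {a p q : W} (h : G.Br a q p) :
    ∃ P, G.IsSimplePathFromTo P p q ∧ preterminal P = some a := by
  obtain ⟨P, ⟨⟨hw, hn⟩, hh, hl⟩, hv⟩ := h.2.exists_path
  refine ⟨P ++ [q], ⟨⟨?_, ?_⟩, ?_, by simp⟩, by simpa [preterminal] using hl⟩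
  · rw [isWalk_iff] at hw ⊢
    refine ⟨by simp, ?_⟩
    rw [List.isChain_append]
    refine ⟨hw.2, by simp, ?_⟩
    intro x hx y hy
    rw [hl] at hx
    simp at hx hy
    subst hx hy
    exact h.1
  · rw [List.nodup_append]
    refine ⟨hn, by simp, ?_⟩
    intro x hx y hy
    simp at hy
    subst hy
    rintro rfl
    exact hv hx
  · cases P
    · exact hw.elim
    · simpa using hh

theorem dbl_iff {p q : W} (hne : p ≠ q) : G.Dbl p q ↔
    ∃ P Q, G.IsSimplePathFromTo P p q ∧ G.IsSimplePathFromTo Q p q ∧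
      preterminal P ≠ preterminal Q := by
  constructor
  · rintro ⟨a, b, hab, ha, hb⟩
    obtain ⟨P, hP, hPa⟩ := ha.exists_path
    obtain ⟨Q, hQ, hQb⟩ := hb.exists_path
    exact ⟨P, Q, hP, hQ, by simpa [hPa, hQb] using hab⟩
  · rintro ⟨P, Q, hP, hQ, hPQ⟩
    obtain ⟨a, _, _, _, _, ha, ha'⟩ := path_decomp hne hP
    obtain ⟨b, _, _, _, _, hb, hb'⟩ := path_decomp hne hQ
    refine ⟨a, b, ?_, ha', hb'⟩
    rintro rfl
    exact hPQ (ha.trans hb.symm)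

theorem Dbl.ne {p q : W} (h : G.Dbl p q) : p ≠ q := by
  obtain ⟨_, _, _, h, _⟩ := h
  exact h.2.1

theorem dbcp_iff {p q : W} : G.Dbcp p q ↔ G.Dbl p q ∧ G.Dbl q p := by
  constructor
  · rintro ⟨h, h1, h2⟩
    exact ⟨(dbl_iff h).2 h1, (dbl_iff h.symm).2 h2⟩
  · rintro ⟨h1, h2⟩
    exact ⟨h1.ne, (dbl_iff h1.ne).1 h1, (dbl_iff h2.ne).1 h2⟩

theorem mem_arcs_last {v b : W} {P : List W} {x : W} (hv : v ∉ P) :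
    (b, v) ∈ arcs (x :: (P ++ [v])) ↔ (x :: P).getLast? = some b := by
  induction P generalizing x with
  | nil => simp [arcs, eq_comm]
  | cons y P ih =>
    simp only [List.mem_cons, not_or] at hv
    have := ih (x := y) hv.2
    have e : arcs (x :: (y :: P ++ [v])) = (x, y) :: arcs (y :: (P ++ [v])) := by
      simp [arcs]
    rw [e, List.mem_cons, this]
    simp [hv.1]

/-- In a cactus, no vertex lies in two branches at another vertex. -/
theorem IsCactus.no_dbl (h : G.IsCactus) {a b v w : W} (ha : G.Br a v w) (hb : G.Br b v w) :
    a = b := by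
  obtain ⟨c, hvc, hc⟩ := exists_out (sc_iff.1 h.1 v w) ha.2.1
  have key : ∀ a, G.Br a v w → ∃ P, v ∉ P ∧ G.IsSimpleCycle (v :: (P ++ [v])) ∧
      (v, c) ∈ arcs (v :: (P ++ [v])) ∧ (v :: P).getLast? = some a := by
    intro a ha
    obtain ⟨P, ⟨⟨hw, hn⟩, hh, hl⟩, hv⟩ := (hc.trans ha.2).exists_path
    cases P with
    | nil => exact hw.elim
    | cons d l =>
      simp at hh
      subst hh
      refine ⟨d :: l, hv, ⟨?_, by simp, ?_, ?_⟩, by simp [arcs], by simpa using hl⟩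
      · rw [isWalk_iff] at hw ⊢
        refine ⟨by simp, ?_⟩
        have : v :: (d :: l ++ [v]) = v :: d :: l ++ [v] := rfl
        rw [this, List.isChain_append]
        refine ⟨by simpa using ⟨hvc, hw.2⟩, by simp, ?_⟩
        intro x hx y hy
        simp only [List.getLast?_cons_cons] at hx hl
        rw [hl] at hx
        simp at hx hy
        subst hx hy
        exact ha.1
      · have : v :: (d :: l ++ [v]) = v :: d :: l ++ [v] := rfl
        rw [this, List.getLast?_concat]
        rfl
      · have : (v :: (d :: l ++ [v])).dropLast = v :: d :: l := by
          have : v :: (d :: l ++ [v]) = v :: d :: l ++ [v] := rfl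
          rw [this, List.dropLast_concat]
        rw [this]
        exact List.nodup_cons.2 ⟨hv, hn⟩
  obtain ⟨P, hP, hPc, hPm, hPl⟩ := key a ha
  obtain ⟨Q, hQ, hQc, hQm, hQl⟩ := key b hb
  have := (h.2 v c hvc).2 _ _ hPc hPm hQc hQm (a, v)
  rw [mem_arcs_last hP, mem_arcs_last hQ, hPl, hQl] at this
  simpa [eq_comm] using this

/-- Uniqueness of simple paths when there is no double connection. -/
theorem path_unique (hU : ∀ a b v w, G.Br a v w → G.Br b v w → a = b) {P Q : List W} {x y : W}
    (hP : G.IsSimplePathFromTo P x y) (hQ : G.IsSimplePathFromTo Q x y) : P = Q := by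
  induction hn : P.length generalizing P Q y with
  | zero => rw [List.length_eq_zero_iff] at hn; subst hn; exact hP.1.1.elim
  | succ n ih =>
    by_cases hxy : x = y
    · subst hxy
      have key : ∀ P, G.IsSimplePathFromTo P x x → P = [x] := by
        rintro P ⟨⟨hw, hn⟩, hh, hl⟩
        cases P with
        | nil => exact hw.elim
        | cons d l =>
          simp at hh
          subst hh
          cases l with
          | nil => rfl
          | cons e l =>
            rw [List.getLast?_cons_cons] at hl
            exact ((List.nodup_cons.1 hn).1 (List.mem_of_getLast? hl)).elim
      rw [key P hP, key Q hQ]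
    · obtain ⟨a, P0, rfl, hP0, _, _, ha⟩ := path_decomp hxy hP
      obtain ⟨b, Q0, rfl, hQ0, _, _, hb⟩ := path_decomp hxy hQ
      obtain rfl := hU _ _ _ _ ha hb
      rw [ih hP0 hQ0 (by simpa using hn)]

theorem mem_arcs_cons {a b : W} {l : List W} {e : W × W} :
    e ∈ arcs (a :: b :: l) ↔ e = (a, b) ∨ e ∈ arcs (b :: l) := by
  simp [arcs]

theorem mem_arcs_append {s t : List W} {a : W} {e : W × W} :
    e ∈ arcs (s ++ a :: t) ↔ e ∈ arcs (s ++ [a]) ∨ e ∈ arcs (a :: t) := by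
  induction s with
  | nil => simp [arcs]
  | cons b s ih =>
    cases s with
    | nil => simp [arcs]
    | cons c s =>
      simp only [List.cons_append, mem_arcs_cons] at ih ⊢
      rw [ih, or_assoc]

theorem mem_arcs_iff {p : List W} {x y : W} :
    (x, y) ∈ arcs p ↔ ∃ s t, p = s ++ x :: y :: t := by
  constructor
  · intro h
    induction p with
    | nil => simp [arcs] at h
    | cons a l ih =>
      cases l with
      | nil => simp [arcs] at h
      | cons b l =>
        rcases mem_arcs_cons.1 h with h | h
        · simp only [Prod.mk.injEq] at h
          obtain ⟨rfl, rfl⟩ := h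
          exact ⟨[], l, rfl⟩
        · obtain ⟨s, t, hst⟩ := ih h
          exact ⟨a :: s, t, by simp [hst]⟩
  · rintro ⟨s, t, rfl⟩
    rw [mem_arcs_append]
    right; simp [arcs]

theorem cycle_to_path {p : List W} {x y : W} (hp : G.IsSimpleCycle p) (h : (x, y) ∈ arcs p) :
    ∃ P, G.IsSimplePathFromTo P y x ∧ ∀ e, e ∈ arcs p ↔ e ∈ arcs P ∨ e = (x, y) := by
  obtain ⟨s, t, rfl⟩ := mem_arcs_iff.1 h
  obtain ⟨hw, _, hhl, hn⟩ := hp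
  rw [isWalk_iff] at hw
  have hw := hw.2
  have hxy : x ≠ y := by
    rintro rfl
    have := hw.right_of_append
    simp at this
    exact G.loopless _ this.1
  cases s with
  | nil =>
    rcases List.eq_nil_or_concat' t with rfl | ⟨t, z, rfl⟩
    · simp at hhl; exact (hxy hhl).elim
    · have hz : x = z := by
        have e : [] ++ x :: y :: (t ++ [z]) = (x :: y :: t) ++ [z] := by simp
        rw [e, List.getLast?_concat] at hhl
        simpa using hhl
      subst hz
      refine ⟨y :: (t ++ [x]), ⟨⟨?_, ?_⟩, by simp, ?_⟩, ?_⟩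
      · rw [isWalk_iff]
        refine ⟨by simp, ?_⟩
        simp only [List.nil_append, List.isChain_cons_cons] at hw
        exact hw.2
      · have e : [] ++ x :: y :: (t ++ [x]) = (x :: y :: t) ++ [x] := by simp
        rw [e, List.dropLast_concat] at hn
        have e2 : y :: (t ++ [x]) = (y :: t) ++ [x] := rfl
        rw [e2]
        exact (List.perm_append_singleton x (y :: t)).nodup_iff.2 hn
      · have e2 : y :: (t ++ [x]) = (y :: t) ++ [x] := rfl
        rw [e2, List.getLast?_concat]
      · intro e
        rw [List.nil_append, mem_arcs_cons, or_comm]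
  | cons h0 s =>
    obtain ⟨t', ht'⟩ : ∃ t', y :: t = t' ++ [h0] := by
      apply List.getLast?_eq_some_iff.1
      rw [List.getLast?_append, List.getLast?_cons_cons] at hhl
      cases hq : (y :: t).getLast? with
      | none => simp at hq
      | some z => rw [hq] at hhl; simpa using hhl.symm
    rw [ht'] at hw hn hhl ⊢
    refine ⟨t' ++ h0 :: (s ++ [x]), ⟨⟨?_, ?_⟩, ?_, ?_⟩, ?_⟩
    · rw [isWalk_iff]
      refine ⟨by simp, ?_⟩
      rw [List.isChain_split]
      refine ⟨?_, ?_⟩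
      · have := hw.right_of_append
        exact (List.IsChain.right_of_append (l₁ := [x]) this)
      · have e : h0 :: s ++ x :: (t' ++ [h0]) = (h0 :: (s ++ [x])) ++ (t' ++ [h0]) := by simp
        rw [e] at hw
        exact hw.left_of_append
    · have e : h0 :: s ++ x :: (t' ++ [h0]) = ((h0 :: (s ++ [x])) ++ t') ++ [h0] := by simp
      rw [e, List.dropLast_concat] at hn
      exact List.perm_append_comm.nodup_iff.2 hn
    · cases t' with
      | nil => simp at ht'; simp [ht'.1]
      | cons d t' => simp at ht'; simp [ht'.1]
    · have e : t' ++ h0 :: (s ++ [x]) = (t' ++ h0 :: s) ++ [x] := by simp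
      rw [e, List.getLast?_concat]
    · intro e
      rw [mem_arcs_append, mem_arcs_append (s := t'), ← ht', mem_arcs_cons]
      simp only [List.cons_append]
      tauto

theorem isCactus_of (hG : G.StronglyConnected)
    (hU : ∀ a b v w, G.Br a v w → G.Br b v w → a = b) : G.IsCactus := by
  refine ⟨hG, fun x y hxy => ⟨?_, ?_⟩⟩
  · have hne : x ≠ y := by rintro rfl; exact G.loopless _ hxy
    obtain ⟨a, ha⟩ := exists_br (sc_iff.1 hG y x) hne.symm
    obtain ⟨P, ⟨⟨hw, hn⟩, hh, hl⟩, -⟩ := ha.exists_path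
    cases P with
    | nil => exact hw.elim
    | cons d l =>
      simp at hh
      subst hh
      refine ⟨x :: d :: l, ⟨⟨hxy, hw⟩, by simp, by simp [hl], ?_⟩, by simp [arcs]⟩
      obtain ⟨q, hq⟩ := List.getLast?_eq_some_iff.1 hl
      rw [hq] at hn ⊢
      have e : x :: (q ++ [x]) = (x :: q) ++ [x] := rfl
      rw [e, List.dropLast_concat]
      exact (List.perm_append_singleton x q).nodup_iff.1 hn
  · intro p q hp hpm hq hqm e
    obtain ⟨P, hP, hP'⟩ := cycle_to_path hp hpm
    obtain ⟨Q, hQ, hQ'⟩ := cycle_to_path hq hqm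
    rw [hP', hQ', path_unique hU hP hQ]

end basics

section forward

variable {V V' : Type} {G : DirGraph V} {G' : DirGraph V'} {φ : V' → V}

theorem lift_br (hφ : IsExpansion G' G φ) {a v w : V} (h : G.Br a v w) {v' : V'} (hv : φ v' = v) :
    ∃ a' w', φ a' = a ∧ φ w' = w ∧ G'.Br a' v' w' := by
  obtain ⟨a', ⟨ha, ha'⟩, -⟩ := hφ.lift h.1 v' hv
  have : ∃ w', φ w' = w ∧ G'.RA v' w' a' := by
    obtain ⟨h1, h2⟩ := h.2
    induction h2 using Relation.ReflTransGen.head_induction_on with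
    | refl => exact ⟨a', ha', RA.refl (by rintro rfl; exact h1 (ha'.symm.trans hv))⟩
    | @head b c hbc _ ih =>
      obtain ⟨c', hc, hc'⟩ := ih ⟨h.1, ⟨hbc.2, by assumption⟩⟩ hbc.2
      obtain ⟨b', ⟨hb, hb'⟩, -⟩ := hφ.lift hbc.1 c' hc
      exact ⟨b', hb', RA.head (by rintro rfl; exact h1 (hb'.symm.trans hv)) hb hc'⟩
  obtain ⟨w', hw, hw'⟩ := this
  exact ⟨a', w', ha', hw, ha, hw'⟩

theorem forward [Finite V'] (hφ : IsExpansion G' G φ) (hc : G'.IsCactus) :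
    ∀ p q : V, ¬ G.Dbcp p q := by
  have key : ∀ n : ℕ, ∀ p q : V, G.Dbl p q → G.Dbl q p → ∀ p' q' a' : V', φ p' = p → φ q' = q →
      G'.Br a' q' p' → Set.ncard {w | G'.Br a' q' w} = n → False := by
    intro n
    induction n using Nat.strong_induction_on with
    | _ n ih =>
      intro p q hpq hqp p' q' a' hp hq hB hn
      have : ∃ c' q1', φ q1' = q ∧ G'.Br c' p' q1' ∧ ¬ G'.Br c' p' q' := by
        obtain ⟨a, b, hab, ha, hb⟩ := hqp
        obtain ⟨a1, qa, ha1, hqa, hBa⟩ := lift_br hφ ha hp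
        obtain ⟨b1, qb, hb1, hqb, hBb⟩ := lift_br hφ hb hp
        by_cases h : G'.Br a1 p' q'
        · refine ⟨b1, qb, hqb, hBb, fun h' => hab ?_⟩
          rw [← ha1, ← hb1, hc.no_dbl h h']
        · exact ⟨a1, qa, hqa, hBa, h⟩
      obtain ⟨c, q1, hq1, hB1, hnB⟩ := this
      refine ih _ ?_ q p hqp hpq q1 p' c hq1 hp hB1 rfl
      rw [← hn]
      apply Set.ncard_lt_ncard _ (Set.toFinite _)
      rw [Set.ssubset_iff_of_subset]
      · exact ⟨p', hB, fun h => h.2.1 rfl⟩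
      · intro w hw
        rcases hw.2.split q' with h | h
        · exact ⟨hB.1, (h.tail hw.1 hB.2.1).trans hB.2⟩
        · exact (hnB ⟨hw.1, h.2⟩).elim
  intro p q h
  rw [dbcp_iff] at h
  obtain ⟨hpq, hqp⟩ := h
  obtain ⟨q', hq'⟩ := hφ.vert_surj q
  obtain ⟨a, b, hab, ha, hb⟩ := id hpq
  obtain ⟨a', p', _, hp', hB⟩ := lift_br hφ ha hq'
  exact key _ p q hpq hqp p' q' a' hp' hq' hB rfl

end forward
section order

variable {V : Type} {G : DirGraph V}

/-- The relation between an arc and the arcs spawned by its cycle. -/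
def TR (G : DirGraph V) (e f : V × V) : Prop :=
  G.Br e.1 e.2 f.2 ∧ ∃ w, w ≠ f.1 ∧ G.Br w f.2 e.2

theorem TR.irrefl (e : V × V) : ¬ G.TR e e := fun h => h.1.2.1 rfl

theorem Dbl.trans (hA : ∀ p q, G.Dbl p q → ¬ G.Dbl q p) {y x u : V} (h1 : G.Dbl y x)
    (h2 : G.Dbl x u) : G.Dbl y u := by
  obtain ⟨a, b, hab, ha, hb⟩ := h1
  obtain ⟨c, d, hcd, hc, hd⟩ := id h2
  have fin : ∀ a, G.Br a x y → G.RA u y a → G.Dbl y u := by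
    intro a ha h
    have := h.tail ha.1 hc.2.1
    exact ⟨c, d, hcd, ⟨hc.1, this.trans hc.2⟩, ⟨hd.1, this.trans hd.2⟩⟩
  rcases ha.2.split u with h | h
  · exact fin a ha h
  rcases hb.2.split u with h' | h'
  · exact fin b hb h'
  exact (hA _ _ h2 ⟨a, b, hab, ⟨ha.1, h.2⟩, ⟨hb.1, h'.2⟩⟩).elim

theorem TR.trans_of (hA : ∀ p q, G.Dbl p q → ¬ G.Dbl q p) (hG : G.StronglyConnected)
    {e f g : V × V} (h1 : G.TR e f) (h2 : G.TR f g) (hB : ¬ G.Br f.1 f.2 e.2) : G.TR e g := by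
  obtain ⟨z, y⟩ := e
  obtain ⟨w, x⟩ := f
  obtain ⟨v, u⟩ := g
  obtain ⟨hx, w', hw', hy⟩ := h1
  obtain ⟨hu, v', hv', hx'⟩ := h2
  simp only at *
  have hue : G.Br z y u := by
    rcases hu.2.split y with h | h
    · exact ⟨hx.1, (h.tail hu.1 hx.2.1).trans hx.2⟩
    · exact (hB ⟨hu.1, h.2⟩).elim
  refine ⟨hue, ?_⟩
  rcases hy.2.split u with h | h
  · exact ⟨v', hv', hx'.1, (h.tail hy.1 hx'.2.1).trans hx'.2⟩
  · have hux : G.Dbl u x := ⟨w', w, hw', ⟨hy.1, h.2⟩, hu⟩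
    obtain ⟨v'', hv''⟩ := exists_br (sc_iff.1 hG y u) hue.2.1.symm
    refine ⟨v'', ?_, hv''⟩
    rintro rfl
    rcases hv''.2.split x with h' | h'
    · exact hB ⟨hu.1, (h'.tail hv''.1 hu.2.1).trans hu.2⟩
    · exact hA _ _ hux ⟨v', v'', hv', hx', ⟨hv''.1, h'.2⟩⟩

theorem TR.no_closed [Finite V] (hA : ∀ p q, G.Dbl p q → ¬ G.Dbl q p) (hG : G.StronglyConnected) :
    ∀ (n : ℕ) (S : Set (V × V)), S.ncard = n → (∀ e ∈ S, ∃ f ∈ S, G.TR e f) → S = ∅ := by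
  intro n
  induction n using Nat.strong_induction_on with
  | _ n ih =>
    intro S hn hS
    by_contra hne
    have hne := Set.nonempty_iff_ne_empty.2 hne
    have wf : WellFounded (fun e f : V × V => G.Dbl f.2 e.2) := by
      have : IsTrans (V × V) (fun e f : V × V => G.Dbl f.2 e.2) :=
        ⟨fun a b c h1 h2 => h2.trans hA h1⟩
      have : Std.Irrefl (fun e f : V × V => G.Dbl f.2 e.2) := ⟨fun a h => h.ne rfl⟩
      exact Finite.wellFounded_of_trans_of_irrefl _
    obtain ⟨e, he, hmin⟩ := wf.has_min S hne
    have hK := ih _ (by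
      rw [← hn]
      apply Set.ncard_lt_ncard (s := {f ∈ S | G.TR e f}) _ (Set.toFinite _)
      rw [Set.ssubset_iff_of_subset (fun _ h => h.1)]
      exact ⟨e, he, fun h => TR.irrefl e h.2⟩) {f ∈ S | G.TR e f} rfl (by
      rintro f ⟨hf, hef⟩
      obtain ⟨g, hg, hfg⟩ := hS f hf
      refine ⟨g, ⟨hg, hef.trans_of hA hG hfg ?_⟩, hfg⟩
      intro hB
      obtain ⟨w, hw, hw'⟩ := hef.2
      exact hmin f hf ⟨w, f.1, hw, hw', hB⟩)
    obtain ⟨f, hf, hef⟩ := hS e he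
    have : f ∈ {f ∈ S | G.TR e f} := ⟨hf, hef⟩
    rw [hK] at this
    exact this

theorem TR.acyclic [Finite V] (hA : ∀ p q, G.Dbl p q → ¬ G.Dbl q p) (hG : G.StronglyConnected)
    (e : V × V) : ¬ Relation.TransGen G.TR e e := by
  intro h
  have := TR.no_closed hA hG _ {f | Relation.TransGen G.TR f e} rfl (by
    intro f hf
    rcases Relation.TransGen.head'_iff.1 hf with ⟨g, hfg, hge⟩
    rcases Relation.reflTransGen_iff_eq_or_transGen.1 hge with rfl | hge
    · exact ⟨_, h, hfg⟩
    · exact ⟨g, hge, hfg⟩)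
  have he : e ∈ {f | Relation.TransGen G.TR f e} := h
  rw [this] at he
  exact he

/-- Breadth-first predecessor function. -/
theorem exists_pred (hG : G.StronglyConnected) (y : V) :
    ∃ (d : V → ℕ) (π : V → V), ∀ x, x ≠ y → G.Adj (π x) x ∧ d (π x) < d x := by
  classical
  obtain ⟨R, hR0, hRs⟩ : ∃ R : ℕ → V → Prop, (∀ x, R 0 x ↔ x = y) ∧
      ∀ n x, R (n + 1) x ↔ ∃ u, R n u ∧ G.Adj u x :=
    ⟨fun n => Nat.rec (fun x => x = y) (fun _ P x => ∃ u, P u ∧ G.Adj u x) n,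
      fun _ => Iff.rfl, fun _ _ => Iff.rfl⟩
  have hR : ∀ x, ∃ n, R n x := by
    intro x
    have := sc_iff.1 hG y x
    induction this with
    | refl => exact ⟨0, (hR0 _).2 rfl⟩
    | tail _ h ih =>
      obtain ⟨n, hn⟩ := ih
      exact ⟨n + 1, (hRs _ _).2 ⟨_, hn, h⟩⟩
  have : ∀ x : V, ∃ u : V, x ≠ y → G.Adj u x ∧ Nat.find (hR u) < Nat.find (hR x) := by
    intro x
    by_cases hx : x = y
    · exact ⟨x, fun h => (h hx).elim⟩
    · have hs := Nat.find_spec (hR x)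
      generalize Nat.find (hR x) = n at hs
      cases n with
      | zero => exact (hx ((hR0 _).1 hs)).elim
      | succ n =>
        obtain ⟨u, hu, hux⟩ := (hRs _ _).1 hs
        exact ⟨u, fun _ => ⟨hux, Nat.lt_succ_of_le (Nat.find_min' (hR u) hu)⟩⟩
  choose π hπ using this
  exact ⟨fun x => Nat.find (hR x), π, hπ⟩

theorem pred_RA {y : V} {d : V → ℕ} {π : V → V}
    (h : ∀ x, x ≠ y → G.Adj (π x) x ∧ d (π x) < d x) {x : V} (hx : x ≠ y) : G.RA x y (π x) := by
  have key : ∀ n u, d u = n → n < d x → G.RA x y u := by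
    intro n
    induction n using Nat.strong_induction_on with
    | _ n ih =>
      intro u hu hn
      by_cases huy : u = y
      · subst huy; exact RA.refl hx.symm
      · have := h u huy
        refine (ih (d (π u)) (by omega) _ rfl (by omega)).tail this.1 ?_
        rintro rfl
        omega
  exact key _ _ rfl (h x hx).2

end order

section construction

variable {V : Type} (G : DirGraph V) (π : V → V → V) (r : V)

/-- The vertex of `G` under a node. -/
def vtx : List (V × V) → V
  | [] => r
  | (x, _) :: _ => x

/-- The predecessor of the node along its parent cycle. -/
def Par : List (V × V) → V → Prop
  | [], _ => False
  | (x, _) :: k, w => w = π (vtx r k) x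

/-- `x` is on the tree path from `y` to `z`. -/
def Anc (y x z : V) : Prop := Relation.ReflTransGen (fun a b => b ≠ y ∧ a = π y b) x z

/-- Valid nodes. -/
def Valid : List (V × V) → Prop
  | [] => True
  | (x, z) :: k => Valid k ∧ G.Adj z (vtx r k) ∧ ¬ Par π r k z ∧ x ≠ vtx r k ∧ Anc π (vtx r k) x z

open Classical in
/-- Source of the lifted arc. -/
noncomputable def src : List (V × V) → V → List (V × V)
  | [], w => [(w, w)]
  | (x, z) :: k, w => if w = π (vtx r k) x then (if w = vtx r k then k else (w, z) :: k)
      else (w, w) :: (x, z) :: k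

open Classical in
/-- Label of the branch at `l`. -/
noncomputable def lab (l : List (V × V)) : List (V × V) → Option V
  | [] => none
  | (_, z) :: k => if k = l then some z else lab l k

variable {π r}

theorem src_new {l : List (V × V)} {w : V} (h : ¬ Par π r l w) : src π r l w = (w, w) :: l := by
  cases l with
  | nil => rfl
  | cons a k => obtain ⟨x, z⟩ := a; simp only [Par] at h; simp [src, h]

theorem src_par {k : List (V × V)} {x z w : V} (h : w = π (vtx r k) x) (h' : w = vtx r k) :
    src π r ((x, z) :: k) w = k := by
  rw [src, if_pos h, if_pos h']

theorem src_sib {k : List (V × V)} {x z w : V} (h : w = π (vtx r k) x) (h' : w ≠ vtx r k) :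
    src π r ((x, z) :: k) w = (w, z) :: k := by
  rw [src, if_pos h, if_neg h']

theorem src_cases (l : List (V × V)) (w : V) :
    (¬ Par π r l w ∧ src π r l w = (w, w) :: l) ∨
    (Par π r l w ∧ ∃ x z k, l = (x, z) :: k ∧ w = π (vtx r k) x ∧
      (w = vtx r k ∧ src π r l w = k ∨ w ≠ vtx r k ∧ src π r l w = (w, z) :: k)) := by
  by_cases h : Par π r l w
  · right
    refine ⟨h, ?_⟩
    cases l with
    | nil => exact h.elim
    | cons a k =>
      obtain ⟨x, z⟩ := a
      refine ⟨x, z, k, rfl, h, ?_⟩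
      by_cases h' : w = vtx r k
      · exact .inl ⟨h', src_par h h'⟩
      · exact .inr ⟨h', src_sib h h'⟩
  · exact .inl ⟨h, src_new h⟩

theorem vtx_src (l : List (V × V)) (w : V) : vtx r (src π r l w) = w := by
  rcases src_cases (π := π) (r := r) l w with ⟨_, h⟩ | ⟨_, x, z, k, rfl, h1, h | h⟩
  · rw [h]; rfl
  · rw [h.2, h.1]
  · rw [h.2]; rfl

variable {G}

theorem valid_src {l : List (V × V)} {w : V} (hl : Valid G π r l) (hw : G.Adj w (vtx r l)) :
    Valid G π r (src π r l w) := by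
  rcases src_cases (π := π) (r := r) l w with ⟨hp, h⟩ | ⟨_, x, z, k, rfl, h1, h | h⟩
  · rw [h]
    exact ⟨hl, hw, hp, fun h => G.loopless w (by rw [← h] at hw; exact hw), .refl⟩
  · rw [h.2]; exact hl.1
  · rw [h.2]
    obtain ⟨a, b, c, d, e⟩ := hl
    exact ⟨a, b, c, h.1, Relation.ReflTransGen.head ⟨d, h1⟩ e⟩

theorem lab_short {l m : List (V × V)} (h : m.length ≤ l.length) : lab l m = none := by
  induction m with
  | nil => rfl
  | cons a k ih =>
    obtain ⟨x, z⟩ := a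
    simp only [List.length_cons] at h
    have : k ≠ l := by rintro rfl; omega
    rw [lab, if_neg this, ih (by omega)]

theorem lab_step {l m : List (V × V)} {w : V} (h1 : m ≠ l) (h2 : src π r m w ≠ l) :
    lab l (src π r m w) = lab l m := by
  rcases src_cases (π := π) (r := r) m w with ⟨hp, h⟩ | ⟨_, x, z, k, rfl, _, h | h⟩
  · rw [h, lab, if_neg h1]
  · rw [h.2] at h2 ⊢
    rw [lab, if_neg h2]
  · rw [h.2, lab, lab]

theorem lab_in {l : List (V × V)} {w : V} :
    (Par π r l w ∧ lab l (src π r l w) = none) ∨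
    (¬ Par π r l w ∧ lab l (src π r l w) = some w) := by
  rcases src_cases (π := π) (r := r) l w with ⟨hp, h⟩ | ⟨hp, x, z, k, rfl, _, h | h⟩
  · right; rw [h, lab, if_pos rfl]; exact ⟨hp, rfl⟩
  · left; rw [h.2]; exact ⟨hp, lab_short (by simp)⟩
  · left; rw [h.2]; exact ⟨hp, lab_short (by simp)⟩

variable (G π r) in
/-- The expansion. -/
noncomputable def exp : DirGraph {l : List (V × V) // Valid G π r l} where
  Adj m l := G.Adj (vtx r m.1) (vtx r l.1) ∧ m.1 = src π r l.1 (vtx r m.1)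
  loopless _ h := G.loopless _ h.1

theorem exp_unique (a b v w : {l : List (V × V) // Valid G π r l})
    (ha : (exp G π r).Br a v w) (hb : (exp G π r).Br b v w) : a = b := by
  have key : ∀ a, (exp G π r).RA v w a → lab v.1 w.1 = lab v.1 a.1 := by
    rintro a ⟨h1, h2⟩
    induction h2 with
    | refl => rfl
    | @tail b c hb hc ih =>
      rw [ih]
      have hbv : b ≠ v := RA.ne_right (G := exp G π r) ⟨h1, hb⟩
      obtain ⟨⟨_, h⟩, hcv⟩ := hc
      rw [h]
      apply lab_step
      · exact fun h => hcv (Subtype.ext h)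
      · rw [← h]; exact fun h => hbv (Subtype.ext h)
  have h := (key a ha.2).symm.trans (key b hb.2)
  have ea := ha.1.2
  have eb := hb.1.2
  have : vtx r a.1 = vtx r b.1 := by
    rw [ea, eb] at h
    rcases lab_in (π := π) (r := r) (l := v.1) (w := vtx r a.1) with ⟨pa, la⟩ | ⟨pa, la⟩ <;>
    rcases lab_in (π := π) (r := r) (l := v.1) (w := vtx r b.1) with ⟨pb, lb⟩ | ⟨pb, lb⟩ <;>
    rw [la, lb] at h
    · generalize vtx r a.1 = s at *
      generalize vtx r b.1 = t at *
      generalize v.1 = l at *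
      cases l with
      | nil => exact pa.elim
      | cons c k => obtain ⟨x, z⟩ := c; exact pa.trans pb.symm
    · simp at h
    · simp at h
    · simpa using h
  apply Subtype.ext
  rw [ea, eb, this]

/-- The list of arcs opening the cycles along a node. -/
def opens (r : V) : List (V × V) → List (V × V)
  | [] => []
  | (_, z) :: k => (z, vtx r k) :: opens r k

theorem opens_length (l : List (V × V)) : (opens r l).length = l.length := by
  induction l with
  | nil => rfl
  | cons a k ih => simp [opens, ih]

theorem anc_RA {d : V → V → ℕ} (hπ : ∀ y x, x ≠ y → G.Adj (π y x) x ∧ d y (π y x) < d y x)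
    {y x z : V} (hx : x ≠ y) (h : Anc π y x z) : G.RA y x z := by
  induction h with
  | refl => exact RA.refl hx
  | tail _ h ih =>
    obtain ⟨h1, rfl⟩ := h
    exact ih.tail (hπ _ _ h1).1 h1

theorem opens_chain {d : V → V → ℕ} (hπ : ∀ y x, x ≠ y → G.Adj (π y x) x ∧ d y (π y x) < d y x)
    {l : List (V × V)} (hl : Valid G π r l) :
    List.IsChain (flip G.TR) (opens r l) := by
  induction l with
  | nil => simp [opens]
  | cons a k ih =>
    obtain ⟨x, z⟩ := a
    cases k with
    | nil => simp [opens]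
    | cons b k =>
      obtain ⟨x1, z1⟩ := b
      have ih := ih hl.1
      obtain ⟨⟨h1, h2, h3, h4, h5⟩, h6, h7, h8, h9⟩ := hl
      simp only [opens, List.isChain_cons_cons] at ih ⊢
      refine ⟨⟨⟨h2, anc_RA hπ h4 h5⟩, π (vtx r k) x1, Ne.symm h7, (hπ _ _ h4).1, pred_RA (hπ _) h4⟩, ih⟩

theorem finite_valid {d : V → V → ℕ} (hπ : ∀ y x, x ≠ y → G.Adj (π y x) x ∧ d y (π y x) < d y x)
    [Finite V] (hA : ∀ p q, G.Dbl p q → ¬ G.Dbl q p) (hG : G.StronglyConnected) :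
    Finite {l : List (V × V) // Valid G π r l} := by
  apply Set.Finite.subset (List.finite_length_le (V × V) (Nat.card (V × V)))
  intro l hl
  have h1 : List.IsChain (flip (Relation.TransGen G.TR)) (opens r l) :=
    (opens_chain hπ hl).imp (fun a b h => Relation.TransGen.single h)
  have : IsTrans (V × V) (flip (Relation.TransGen G.TR)) := ⟨fun a b c h h' => h'.trans h⟩
  have h2 := List.isChain_iff_pairwise.1 h1
  have h3 : (opens r l).Nodup := by
    refine h2.imp ?_
    rintro a b h rfl
    exact TR.acyclic hA hG a h
  have := Fintype.ofFinite (V × V)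
  have := h3.length_le_card
  rw [opens_length] at this
  simpa [Nat.card_eq_fintype_card] using this

theorem reach_down {d : V → V → ℕ} (hπ : ∀ y x, x ≠ y → G.Adj (π y x) x ∧ d y (π y x) < d y x)
    {k : List (V × V)} {x z : V} (hl : Valid G π r ((x, z) :: k)) :
    Relation.ReflTransGen (exp G π r).Adj ⟨(x, z) :: k, hl⟩ ⟨k, hl.1⟩ := by
  obtain ⟨h1, h2, h3, h4, h5⟩ := id hl
  have key : ∀ x, Anc π (vtx r k) x z → ∀ hl : Valid G π r ((x, z) :: k),
      Relation.ReflTransGen (exp G π r).Adj ⟨(x, z) :: k, hl⟩ ⟨k, hl.1⟩ := by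
    intro x hx
    induction hx using Relation.ReflTransGen.head_induction_on with
    | refl =>
      intro hl
      exact .single ⟨h2, (src_new h3).symm⟩
    | @head a b hab hb ih =>
      intro hl
      obtain ⟨hb1, hb2⟩ := hab
      have hv : Valid G π r ((b, z) :: k) := ⟨h1, h2, h3, hb1, hb⟩
      refine .head ?_ (ih hv)
      refine ⟨?_, (src_sib hb2 hl.2.2.2.1).symm⟩
      show G.Adj a b
      rw [hb2]; exact (hπ _ _ hb1).1
  exact key x h5 hl

theorem reach_up {d : V → V → ℕ} (hπ : ∀ y x, x ≠ y → G.Adj (π y x) x ∧ d y (π y x) < d y x)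
    {k : List (V × V)} {x z : V} (hl : Valid G π r ((x, z) :: k)) :
    Relation.ReflTransGen (exp G π r).Adj ⟨k, hl.1⟩ ⟨(x, z) :: k, hl⟩ := by
  induction hn : d (vtx r k) x using Nat.strong_induction_on generalizing x with
  | _ n ih =>
    obtain ⟨h1, h2, h3, h4, h5⟩ := id hl
    obtain ⟨ha, hd⟩ := hπ _ _ h4
    by_cases h : π (vtx r k) x = vtx r k
    · refine .single ⟨?_, (src_par h.symm rfl).symm⟩
      show G.Adj (vtx r k) x
      rw [h] at ha; exact ha
    · have hv : Valid G π r ((π (vtx r k) x, z) :: k) :=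
        ⟨h1, h2, h3, h, Relation.ReflTransGen.head ⟨h4, rfl⟩ h5⟩
      exact (ih _ (by omega) hv rfl).tail ⟨ha, (src_sib rfl h).symm⟩

theorem exp_sc {d : V → V → ℕ} (hπ : ∀ y x, x ≠ y → G.Adj (π y x) x ∧ d y (π y x) < d y x)
    : (exp G π r).StronglyConnected := by
  have key : ∀ (l : List (V × V)) (hl : Valid G π r l),
      Relation.ReflTransGen (exp G π r).Adj ⟨l, hl⟩ ⟨[], trivial⟩ ∧
      Relation.ReflTransGen (exp G π r).Adj ⟨[], trivial⟩ ⟨l, hl⟩ := by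
    intro l
    induction l with
    | nil => intro _; exact ⟨.refl, .refl⟩
    | cons a k ih =>
      obtain ⟨x, z⟩ := a
      intro hl
      exact ⟨(reach_down hπ hl).trans (ih hl.1).1, (ih hl.1).2.trans (reach_up hπ hl)⟩
  rw [sc_iff]
  rintro ⟨x, hx⟩ ⟨y, hy⟩
  exact (key x hx).1.trans (key y hy).2

theorem exp_isExpansion (hG : G.StronglyConnected) :
    IsExpansion (exp G π r) G (fun l => vtx r l.1) := by
  have lft : ∀ ⦃x y⦄, G.Adj x y → ∀ y' : {l : List (V × V) // Valid G π r l}, vtx r y'.1 = y →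
      ∃! x' : {l : List (V × V) // Valid G π r l}, (exp G π r).Adj x' y' ∧ vtx r x'.1 = x := by
    rintro x y hxy ⟨l, hl⟩ rfl
    refine ⟨⟨src π r l x, valid_src hl hxy⟩, ⟨⟨?_, ?_⟩, vtx_src l x⟩, ?_⟩
    · simpa only [vtx_src] using hxy
    · simp only [vtx_src]
    · rintro ⟨m, hm⟩ ⟨⟨_, h⟩, rfl⟩
      exact Subtype.ext h
  have surj : Function.Surjective (fun l : {l : List (V × V) // Valid G π r l} => vtx r l.1) := by
    intro x
    have := sc_iff.1 hG x r
    induction this using Relation.ReflTransGen.head_induction_on with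
    | refl => exact ⟨⟨[], trivial⟩, rfl⟩
    | @head a b hab _ ih =>
      obtain ⟨y', hy'⟩ := ih
      obtain ⟨x', hx', _⟩ := lft hab y' hy'
      exact ⟨x', hx'.2⟩
  refine ⟨fun x y h => h.1, surj, ?_, lft⟩
  intro x y hxy
  obtain ⟨y', hy'⟩ := surj y
  obtain ⟨x', hx', _⟩ := lft hxy y' hy'
  exact ⟨x', y', hx'.1, hx'.2, hy'⟩

end construction

theorem backward {V : Type} [Finite V] (G : DirGraph V) (hG : G.StronglyConnected)
    (h : ∀ p q : V, ¬ G.Dbcp p q) :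
    ∃ (V' : Type) (_ : Finite V') (G' : DirGraph V') (φ : V' → V),
      DirGraph.IsExpansion G' G φ ∧ G'.IsCactus := by
  rcases isEmpty_or_nonempty V with hV | ⟨⟨r⟩⟩
  · exact ⟨V, inferInstance, G, id, ⟨fun x => hV.elim x, Function.surjective_id,
      fun x => hV.elim x, fun x => hV.elim x⟩, hG, fun x => hV.elim x⟩
  · have hA : ∀ p q, G.Dbl p q → ¬ G.Dbl q p := fun p q h1 h2 => h p q (dbcp_iff.2 ⟨h1, h2⟩)
    choose d π hπ using exists_pred hG
    exact ⟨_, finite_valid (r := r) hπ hA hG, exp G π r, fun l => vtx r l.1, exp_isExpansion hG,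
      isCactus_of (exp_sc hπ) exp_unique⟩

end DirGraph

/-- A strongly connected digraph admits a cactus expansion iff it has no
doubly bidirectionally connected pair. -/
theorem cactus_expandable_iff_no_dbcp {V : Type} [Finite V] (G : DirGraph V)
    (hG : G.StronglyConnected) :
    (∃ (V' : Type) (_ : Finite V') (G' : DirGraph V') (φ : V' → V),
      DirGraph.IsExpansion G' G φ ∧ G'.IsCactus) ↔
    ∀ p q : V, ¬ G.Dbcp p q := by
  exact ⟨fun ⟨_, _, _, _, hφ, hc⟩ => DirGraph.forward hφ hc, DirGraph.backward G hG⟩
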